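/- Let K be a number field and suppose x ∈ K* has the property that its image in K*/(K*)^ℓ lies in the subgroup generated by fixed elements y_1, ..., y_d ∈ K* for infinitely many primes ℓ. Then some positive power of x lies in the subgroup of K* generated by y_1, ..., y_d. -/

import Mathlib

open IsDedekindDomain NumberField

/-- An element of a finitely generated abelian group that is divisible by infinitely many
natural numbers is torsion. -/
theorem exists_pos_nsmul_eq_zero_of_infinite_divisors {A : Type*} [AddCommGroup A]
    [Module.Finite ℤ A] (a : A) (h : {n : ℕ | ∃ b : A, n • b = a}.Infinite) :
    ∃ N : ℕ, 0 < N ∧ N • a = 0 := by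
  have ha : (Submodule.torsion ℤ A).mkQ a = 0 := by
    let B := Module.Free.chooseBasis ℤ (A ⧸ Submodule.torsion ℤ A)
    refine B.ext_elem fun i => ?_
    rw [map_zero, Finsupp.zero_apply]
    by_contra hne
    refine h ((Set.finite_le_nat (B.repr ((Submodule.torsion ℤ A).mkQ a) i).natAbs).subset ?_)
    rintro n ⟨b, rfl⟩
    refine Nat.le_of_dvd (Int.natAbs_pos.mpr hne) (Int.natCast_dvd.mp ?_)
    simp
  rw [Submodule.mkQ_apply, Submodule.Quotient.mk_eq_zero, Submodule.mem_torsion_iff] at ha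
  obtain ⟨c, hc⟩ := ha
  refine ⟨(c : ℤ).natAbs, Int.natAbs_pos.mpr (nonZeroDivisors.coe_ne_zero c), ?_⟩
  rw [← natCast_zsmul]
  have hc' : (c : ℤ) • a = 0 := hc
  rcases Int.natAbs_eq (c : ℤ) with h | h <;> rw [h] at hc' <;> simpa using hc'

theorem finite_setOf_valuation_ne_one (R : Type*) [CommRing R] [IsDedekindDomain R]
    {K : Type*} [Field K] [Algebra R K] [IsFractionRing R K] {x : K} (hx : x ≠ 0) :
    {v : HeightOneSpectrum R | v.valuation K x ≠ 1}.Finite := by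
  refine ((HeightOneSpectrum.Support.finite R x).union
    (HeightOneSpectrum.Support.finite R x⁻¹)).subset fun v hv => ?_
  rcases lt_or_gt_of_ne hv with h | h
  · right
    change 1 < v.valuation K x⁻¹
    rw [map_inv₀]
    exact (one_lt_inv₀ (by simpa [zero_lt_iff] using hx)).mpr h
  · exact Or.inl h

/-- An element of `Kˣ` with trivial valuation at every prime comes from a unit of `R`. -/
theorem exists_unit_of_forall_valuation_eq_one (R : Type*) [CommRing R] [IsDedekindDomain R]
    {K : Type*} [Field K] [Algebra R K] [IsFractionRing R K] (x : Kˣ)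
    (hx : ∀ v : HeightOneSpectrum R, v.valuation K (x : K) = 1) :
    ∃ u : Rˣ, Units.map (algebraMap R K : R →* K) u = x := by
  obtain ⟨r, hr⟩ := HeightOneSpectrum.mem_integers_of_valuation_le_one (R := R) K (x : K)
    fun v => (hx v).le
  obtain ⟨s, hs⟩ := HeightOneSpectrum.mem_integers_of_valuation_le_one (R := R) K ((x⁻¹ : Kˣ) : K)
    fun v => by simp [hx v]
  have hrs : r * s = 1 := IsFractionRing.injective R K (by simp [hr, hs])
  exact ⟨⟨r, s, hrs, by rw [mul_comm, hrs]⟩, Units.ext hr⟩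

/-- The group of `S`-units of a number field is finitely generated for finite `S`. -/
theorem fg_unit_of_finite (K : Type*) [Field K] [NumberField K]
    (S : Set (HeightOneSpectrum (𝓞 K))) (hS : S.Finite) :
    (AddSubgroup.toIntSubmodule (S.unit K).toAddSubgroup).FG := by
  have := hS.to_subtype
  let g : Additive Kˣ →+ (S → ℤ) := AddMonoidHom.pi fun v =>
    MonoidHom.toAdditiveLeft (v : HeightOneSpectrum (𝓞 K)).valuationOfNeZero
  let i : Additive (𝓞 K)ˣ →+ Additive Kˣ :=
    MonoidHom.toAdditive (Units.map (algebraMap (𝓞 K) K : 𝓞 K →* K))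
  refine Submodule.fg_of_fg_map_of_fg_inf_ker g.toIntLinearMap (IsNoetherian.noetherian _) ?_
  suffices hker : AddSubgroup.toIntSubmodule (S.unit K).toAddSubgroup ⊓
      LinearMap.ker g.toIntLinearMap = (⊤ : Submodule ℤ _).map i.toIntLinearMap by
    rw [hker]
    exact Module.Finite.fg_top.map _
  ext x
  constructor
  · rintro ⟨hx, hgx⟩
    obtain ⟨u, hu⟩ := exists_unit_of_forall_valuation_eq_one (𝓞 K) x.toMul fun v => by
      by_cases hv : v ∈ S
      · have h1 : v.valuationOfNeZero x.toMul = 1 := congrFun hgx ⟨v, hv⟩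
        rw [← v.valuationOfNeZero_eq, h1, WithZero.coe_one]
      · exact Set.unit_valuation_eq_one S K ⟨x.toMul, hx⟩ hv
    exact ⟨Additive.ofMul u, trivial, hu⟩
  · rintro ⟨u, -, rfl⟩
    have key (v : HeightOneSpectrum (𝓞 K)) := v.valuation_of_unit_eq (K := K) u.toMul
    refine ⟨?_, funext fun v => key v⟩
    intro v _
    change v.valuation K (Units.map (algebraMap (𝓞 K) K : 𝓞 K →* K) u.toMul : K) = 1
    rw [← v.valuationOfNeZero_eq, key v, WithZero.coe_one]

theorem stmt_15 (K : Type*) [Field K] [NumberField K] (d : ℕ)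
    (x : K) (hx : x ≠ 0) (y : Fin d → K) (hy : ∀ i, y i ≠ 0)
    (h : {ℓ : ℕ | ℓ.Prime ∧ ∃ (n : Fin d → ℤ) (z : K), z ≠ 0 ∧
      x = (∏ i, y i ^ n i) * z ^ (ℓ : ℤ)}.Infinite) :
    ∃ N : ℕ, 0 < N ∧ ∃ m : Fin d → ℤ, x ^ (N : ℤ) = ∏ i, y i ^ m i := by
  let S : Set (HeightOneSpectrum (𝓞 K)) :=
    {v | v.valuation K x ≠ 1} ∪ ⋃ i, {v | v.valuation K (y i) ≠ 1}
  have hS : S.Finite := (finite_setOf_valuation_ne_one (𝓞 K) hx).union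
    (Set.finite_iUnion fun i => finite_setOf_valuation_ne_one (𝓞 K) (hy i))
  have hSx (v) (hv : v ∉ S) : v.valuation K x = 1 := by
    by_contra hne
    exact hv (Or.inl hne)
  have hSy (v) (hv : v ∉ S) (i) : v.valuation K (y i) = 1 := by
    by_contra hne
    exact hv (Or.inr (Set.mem_iUnion.mpr ⟨i, hne⟩))
  let X : Additive Kˣ := Additive.ofMul (Units.mk0 x hx)
  let Y : Fin d → Additive Kˣ := fun i => Additive.ofMul (Units.mk0 (y i) (hy i))
  let Q := Submodule.span ℤ (Set.range Y)
  let U := AddSubgroup.toIntSubmodule (S.unit K).toAddSubgroup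
  let P := U.map Q.mkQ
  have hYval (m : Fin d → ℤ) : ((∑ i, m i • Y i).toMul : K) = ∏ i, y i ^ m i := by
    simp [Y, toMul_sum]
  have : Module.Finite ℤ P := Module.Finite.iff_fg.mpr ((fg_unit_of_finite K S hS).map _)
  have hXU : X ∈ U := hSx
  let X' : P := ⟨Q.mkQ X, X, hXU, rfl⟩
  have hdiv : {ℓ : ℕ | ℓ.Prime ∧ ∃ (n : Fin d → ℤ) (z : K), z ≠ 0 ∧
      x = (∏ i, y i ^ n i) * z ^ (ℓ : ℤ)} ⊆ {n : ℕ | ∃ b : P, n • b = X'} := by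
    rintro ℓ ⟨hℓ, n, z, hz, hxz⟩
    have hzU : Additive.ofMul (Units.mk0 z hz) ∈ U := by
      intro v hv
      have hval := congrArg (v.valuation K) hxz
      simp only [hSx v hv, map_mul, map_prod, map_zpow₀, hSy v hv, one_zpow,
        Finset.prod_const_one, one_mul, zpow_natCast, map_pow] at hval
      exact (pow_eq_one_iff.mp hval.symm).resolve_right hℓ.ne_zero
    refine ⟨⟨Q.mkQ (Additive.ofMul (Units.mk0 z hz)), _, hzU, rfl⟩, Subtype.ext ?_⟩
    change ℓ • Q.mkQ (Additive.ofMul (Units.mk0 z hz)) = Q.mkQ X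
    have hX : X = ∑ i, n i • Y i + ℓ • Additive.ofMul (Units.mk0 z hz) := by
      apply Additive.toMul.injective
      apply Units.ext
      rw [toMul_add, Units.val_mul, hYval]
      simpa [X] using hxz
    have h0 : Q.mkQ (∑ i, n i • Y i) = 0 := (Submodule.Quotient.mk_eq_zero _).mpr <|
      Submodule.sum_mem _ fun i _ => Submodule.smul_mem _ _ (Submodule.subset_span ⟨i, rfl⟩)
    rw [hX, map_add, h0, zero_add, map_nsmul]
  obtain ⟨N, hN, hNX⟩ := exists_pos_nsmul_eq_zero_of_infinite_divisors X' (h.mono hdiv)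
  have hmem : N • X ∈ Q := by
    rw [← Submodule.Quotient.mk_eq_zero]
    exact congrArg Subtype.val hNX
  obtain ⟨m, hm⟩ := Submodule.mem_span_range_iff_exists_fun ℤ |>.mp hmem
  refine ⟨N, hN, m, ?_⟩
  rw [← hYval, hm]
  simp [X]
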